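/- As n → ∞, the number of semiprimes up to the n-th prime satisfies π₂(p_n) ∼ n · log log n; that is, π₂(p_n) / (n log log n) → 1. -/

import Mathlib

open Filter Real

/-- The i-th prime number, with `nthPrime 1 = 2`, `nthPrime 2 = 3`, etc. -/
noncomputable def nthPrime (i : ℕ) : ℕ := Nat.nth Nat.Prime (i - 1)

/-- The number of semiprimes (positive integers with exactly two prime factors
counted with multiplicity) less than or equal to the natural number k. -/
def semiprimeCount (k : ℕ) : ℕ :=
  ((Finset.range (k + 1)).filter (fun m => m.primeFactorsList.length = 2)).card

section FejerKernel

open MeasureTheory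

/-- The triangle function, supported on `[-1, 1]`. -/
noncomputable def triangle (t : ℝ) : ℝ := max 0 (1 - |t|)

/-- The Fejér kernel, the Fourier transform of `triangle`. -/
noncomputable def fejer (y : ℝ) : ℝ := sinc (y / 2) ^ 2

lemma continuous_triangle : Continuous triangle := by
  unfold triangle; fun_prop

lemma triangle_nonneg (t : ℝ) : 0 ≤ triangle t := le_max_left _ _

lemma triangle_of_mem {t : ℝ} (ht : |t| ≤ 1) : triangle t = 1 - |t| :=
  max_eq_right (by linarith)

lemma triangle_eq_zero {t : ℝ} (ht : 1 ≤ |t|) : triangle t = 0 :=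
  max_eq_left (by linarith)

lemma hasCompactSupport_triangle : HasCompactSupport triangle := by
  refine HasCompactSupport.intro (isCompact_Icc (a := -1) (b := 1)) fun t ht ↦ triangle_eq_zero ?_
  by_contra! h
  exact ht ⟨(abs_lt.mp h).1.le, (abs_lt.mp h).2.le⟩

lemma integrable_triangle : Integrable triangle :=
  continuous_triangle.integrable_of_hasCompactSupport hasCompactSupport_triangle

lemma continuous_fejer : Continuous fejer :=
  (continuous_sinc.comp (continuous_id.div_const 2)).pow 2

lemma fejer_nonneg (y : ℝ) : 0 ≤ fejer y := sq_nonneg _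

lemma fejer_of_ne_zero {y : ℝ} (hy : y ≠ 0) : fejer y = 2 * (1 - cos y) / y ^ 2 := by
  have h : cos y = 1 - 2 * sin (y / 2) ^ 2 := by
    have := cos_two_mul (y / 2)
    rw [show 2 * (y / 2) = y by ring] at this
    linarith [sin_sq_add_cos_sq (y / 2)]
  rw [fejer, sinc_of_ne_zero (by simpa using hy), h]
  field_simp
  ring

lemma fejer_le (y : ℝ) : fejer y ≤ 5 * (1 + y ^ 2)⁻¹ := by
  rw [← div_eq_mul_inv, le_div_iff₀ (by positivity)]
  have h1 : fejer y ≤ 1 := by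
    rw [fejer, sq_le_one_iff_abs_le_one]
    exact abs_sinc_le_one _
  have h2 : fejer y * y ^ 2 ≤ 4 := by
    rcases eq_or_ne y 0 with rfl | hy
    · simp
    · rw [fejer_of_ne_zero hy, div_mul_cancel₀ _ (by positivity)]
      linarith [neg_one_le_cos y]
  linarith

lemma integrable_fejer : Integrable fejer := by
  refine (integrable_inv_one_add_sq.const_mul 5).mono'
    continuous_fejer.aestronglyMeasurable (Eventually.of_forall fun y ↦ ?_)
  rw [norm_of_nonneg (fejer_nonneg y)]
  exact fejer_le y

lemma integral_fejer_pos : 0 < ∫ y, fejer y := by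
  refine integral_pos_of_integrable_nonneg_nonzero continuous_fejer integrable_fejer
    fejer_nonneg (x := 0) ?_
  simp [fejer]

lemma integral_one_sub_mul_cexp {c : ℂ} (hc : c ≠ 0) :
    ∫ t in (0 : ℝ)..1, (1 - (t : ℂ)) * Complex.exp (c * t) =
      (Complex.exp c - 1 - c) / c ^ 2 := by
  have hd (t : ℝ) : HasDerivAt
      (fun t : ℝ ↦ ((1 - (t : ℂ)) / c + 1 / c ^ 2) * Complex.exp (c * t))
      ((1 - (t : ℂ)) * Complex.exp (c * t)) t := by
    have h1 : HasDerivAt (fun t : ℝ ↦ (t : ℂ)) 1 t := Complex.ofRealCLM.hasDerivAt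
    have h2 := (((h1.const_sub 1).div_const c).add_const (1 / c ^ 2)).mul
      (h1.const_mul c).cexp
    refine h2.congr_deriv ?_
    field_simp
    ring
  rw [intervalIntegral.integral_eq_sub_of_hasDerivAt (fun t _ ↦ hd t)
    (Continuous.intervalIntegrable (by fun_prop) _ _)]
  simp
  field_simp
  ring

lemma integral_triangle_mul_cexp (y : ℝ) :
    ∫ t, (triangle t : ℂ) * Complex.exp (Complex.I * y * t) = fejer y := by
  have hset : ∫ t, (triangle t : ℂ) * Complex.exp (Complex.I * y * t) =
      ∫ t in (-1 : ℝ)..1, (triangle t : ℂ) * Complex.exp (Complex.I * y * t) := by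
    rw [intervalIntegral.integral_of_le (by norm_num), setIntegral_eq_integral_of_forall_compl_eq_zero]
    intro t ht
    rw [triangle_eq_zero]
    · simp
    · by_contra! h
      exact ht ⟨(abs_lt.mp h).1, (abs_lt.mp h).2.le⟩
  have hcont : Continuous fun t : ℝ ↦ (triangle t : ℂ) * Complex.exp (Complex.I * y * t) := by
    have := continuous_triangle
    fun_prop
  have hneg : ∫ t in (-1 : ℝ)..0, (triangle t : ℂ) * Complex.exp (Complex.I * y * t) =
      ∫ t in (0 : ℝ)..1, (1 - (t : ℂ)) * Complex.exp (-(Complex.I * y) * t) := by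
    have := intervalIntegral.integral_comp_neg (a := 0) (b := 1)
      (fun t : ℝ ↦ (triangle t : ℂ) * Complex.exp (Complex.I * y * t))
    rw [neg_zero] at this
    rw [← this]
    refine intervalIntegral.integral_congr fun t ht ↦ ?_
    rw [Set.uIcc_of_le zero_le_one] at ht
    have : triangle (-t) = 1 - t := by
      rw [triangle_of_mem] <;> rw [abs_neg, abs_of_nonneg ht.1]
      exact ht.2
    simp [this]
  have hpos : ∫ t in (0 : ℝ)..1, (triangle t : ℂ) * Complex.exp (Complex.I * y * t) =
      ∫ t in (0 : ℝ)..1, (1 - (t : ℂ)) * Complex.exp (Complex.I * y * t) := by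
    refine intervalIntegral.integral_congr fun t ht ↦ ?_
    rw [Set.uIcc_of_le zero_le_one] at ht
    have : triangle t = 1 - t := by
      rw [triangle_of_mem] <;> rw [abs_of_nonneg ht.1]
      exact ht.2
    simp [this]
  rw [hset, ← intervalIntegral.integral_add_adjacent_intervals
    (hcont.intervalIntegrable _ 0) (hcont.intervalIntegrable _ _), hneg, hpos]
  rcases eq_or_ne y 0 with rfl | hy
  · have : ∫ t in (0 : ℝ)..1, (1 - (t : ℂ)) = ((∫ t in (0 : ℝ)..1, (1 - t) : ℝ) : ℂ) := by
      rw [← intervalIntegral.integral_ofReal]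
      simp
    have half : ∫ t in (0 : ℝ)..1, (1 - t) = 1 / 2 := by
      rw [intervalIntegral.integral_sub (by simp) (by simp)]
      simp
      norm_num
    simp [fejer, this, half]
    norm_num
  · have hc : Complex.I * y ≠ 0 := mul_ne_zero Complex.I_ne_zero (by exact_mod_cast hy)
    have hy' : (y : ℂ) ≠ 0 := by exact_mod_cast hy
    rw [integral_one_sub_mul_cexp hc, integral_one_sub_mul_cexp (neg_ne_zero.mpr hc),
      fejer_of_ne_zero hy]
    push_cast
    rw [Complex.cos, neg_sq, mul_pow, Complex.I_sq]
    rw [show -(Complex.I * (y : ℂ)) = -y * Complex.I by ring, mul_comm Complex.I]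
    field_simp
    ring

end FejerKernel

section PsiTransform

open MeasureTheory Chebyshev

/-- `ψ(e^u) / e^u`. -/
noncomputable def psiRatio (u : ℝ) : ℝ := psi (exp u) * exp (-u)

/-- `ψ(e^u) / e^u - 1` on the positive half-line, and `0` elsewhere. -/
noncomputable def psiError (u : ℝ) : ℝ := psiRatio u - (Set.Ioi 0).indicator 1 u

lemma psiRatio_nonneg (u : ℝ) : 0 ≤ psiRatio u := mul_nonneg (psi_nonneg _) (exp_pos _).le

lemma psiRatio_le (u : ℝ) : psiRatio u ≤ log 4 + 4 := by
  have := mul_le_mul_of_nonneg_right (psi_le_const_mul_self (exp_pos u).le) (exp_pos (-u)).le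
  rwa [mul_assoc, ← exp_add, add_neg_cancel, exp_zero, mul_one] at this

lemma measurable_psiRatio : Measurable psiRatio :=
  (psi_mono.measurable.comp measurable_exp).mul (measurable_exp.comp measurable_neg)

lemma psiRatio_of_nonpos {u : ℝ} (hu : u ≤ 0) : psiRatio u = 0 := by
  rw [psiRatio, psi_eq_zero_of_le_one (exp_le_one_iff.mpr hu), zero_mul]

lemma psiRatio_ge_mul_exp {u v : ℝ} (h : u ≤ v) : psiRatio u * exp (u - v) ≤ psiRatio v := by
  rw [psiRatio, psiRatio, mul_assoc, ← exp_add, show -u + (u - v) = -v by ring]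
  gcongr

lemma psiError_of_nonpos {u : ℝ} (hu : u ≤ 0) : psiError u = 0 := by
  simp [psiError, psiRatio_of_nonpos hu, hu]

lemma measurable_psiError : Measurable psiError :=
  measurable_psiRatio.sub (measurable_one.indicator measurableSet_Ioi)

lemma abs_psiError_le (u : ℝ) : |psiError u| ≤ log 4 + 5 := by
  have h4 : 0 ≤ log 4 := log_nonneg (by norm_num)
  have h1 := psiRatio_nonneg u
  have h2 := psiRatio_le u
  by_cases hu : u ∈ Set.Ioi (0 : ℝ) <;> simp only [psiError, Set.indicator, hu, if_true, if_false,
    Pi.one_apply, abs_le] <;> constructor <;> linarith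

lemma integrable_psiError_mul_exp {ε : ℝ} (hε : 0 < ε) :
    Integrable fun u ↦ psiError u * exp (-ε * u) := by
  have h : IntegrableOn (fun u ↦ psiError u * exp (-ε * u)) (Set.Ioi 0) := by
    refine ((integrableOn_exp_mul_Ioi (neg_neg_of_pos hε) 0).const_mul (log 4 + 5)).mono'
      (measurable_psiError.mul (by fun_prop)).aestronglyMeasurable (Eventually.of_forall fun u ↦ ?_)
    rw [norm_mul, norm_of_nonneg (exp_pos _).le]
    gcongr
    exact abs_psiError_le u
  refine (integrableOn_iff_integrable_of_support_subset fun u hu ↦ ?_).mp h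
  by_contra hu'
  exact hu (by simp [psiError_of_nonpos (not_lt.mp hu')])

/-- The continuous extension to `1 ≤ re s` of the Laplace transform of `psiError`. -/
noncomputable def psiTransform (s : ℂ) : ℂ :=
  (ArithmeticFunction.vonMangoldt.LFunctionResidueClassAux (1 : ZMod 1) s - 1) / s

lemma continuousOn_psiTransform : ContinuousOn psiTransform {s | 1 ≤ s.re} := by
  refine ((ArithmeticFunction.vonMangoldt.continuousOn_LFunctionResidueClassAux _).sub
    continuousOn_const).div continuousOn_id fun s hs h ↦ ?_
  simp [h] at hs
  linarith

lemma LSeries_vonMangoldt_eq_mul_integral {s : ℂ} (hs : 1 < s.re) :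
    LSeries (fun n ↦ (ArithmeticFunction.vonMangoldt n : ℂ)) s =
      s * ∫ u in Set.Ioi (0 : ℝ), (psiRatio u : ℂ) * Complex.exp (-(s - 1) * u) := by
  rw [LSeries_eq_mul_integral_of_nonneg (fun n ↦ ArithmeticFunction.vonMangoldt n) zero_le_one hs ?_
    fun _ ↦ ArithmeticFunction.vonMangoldt_nonneg]
  · congr 1
    rw [show Set.Ioi (1 : ℝ) = exp '' Set.Ioi 0 by rw [image_exp_Ioi, exp_zero],
      integral_image_eq_integral_abs_deriv_smul measurableSet_Ioi
        (fun x _ ↦ (hasDerivAt_exp x).hasDerivWithinAt) exp_injective.injOn]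
    refine setIntegral_congr_fun measurableSet_Ioi fun u _ ↦ ?_
    have hpsi : (∑ k ∈ Finset.Icc 1 ⌊exp u⌋₊, (ArithmeticFunction.vonMangoldt k : ℂ)) =
        (psi (exp u) : ℂ) := by
      rw [psi]
      push_cast
      rfl
    simp only [hpsi, abs_of_pos (exp_pos u), psiRatio, Complex.real_smul, Complex.ofReal_mul]
    rw [Complex.cpow_def_of_ne_zero (by simp), ← Complex.ofReal_log (exp_pos u).le, log_exp]
    push_cast
    rw [mul_left_comm, ← Complex.exp_add, mul_assoc, ← Complex.exp_add]
    ring_nf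
  · refine Asymptotics.IsBigO.of_bound (log 4 + 4) (Eventually.of_forall fun n ↦ ?_)
    have h := psi_le_const_mul_self (Nat.cast_nonneg n)
    have h0 := psi_nonneg n
    have he : psi n = ∑ k ∈ Finset.Icc 1 n, ArithmeticFunction.vonMangoldt k := by
      rw [psi, Nat.floor_natCast]
      rfl
    rw [← he, norm_of_nonneg h0, norm_of_nonneg (by positivity)]
    simpa using h

lemma integral_psiError_mul_cexp {ε : ℝ} (hε : 0 < ε) (τ : ℝ) :
    ∫ u, (psiError u : ℂ) * Complex.exp (-(ε + τ * Complex.I) * u) =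
      psiTransform (1 + ε + τ * Complex.I) := by
  set a : ℂ := ε + τ * Complex.I with ha
  have hre : (-a).re < 0 := by simp [ha, hε]
  have ha0 : a ≠ 0 := fun h ↦ by simp [h] at hre
  set s : ℂ := 1 + a with hs
  have hs1 : 1 < s.re := by simp [hs, ha, hε]
  have hs0 : s ≠ 0 := fun h ↦ by rw [h] at hs1; norm_num at hs1
  have hint : ∫ u, (psiError u : ℂ) * Complex.exp (-a * u) =
      ∫ u in Set.Ioi (0 : ℝ), (psiError u : ℂ) * Complex.exp (-a * u) := by
    rw [setIntegral_eq_integral_of_forall_compl_eq_zero]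
    intro u hu
    simp [psiError_of_nonpos (not_lt.mp hu)]
  have hexp : IntegrableOn (fun u : ℝ ↦ Complex.exp (-a * u)) (Set.Ioi 0) :=
    integrableOn_exp_mul_complex_Ioi hre 0
  have hratio : IntegrableOn (fun u : ℝ ↦ (psiRatio u : ℂ) * Complex.exp (-a * u)) (Set.Ioi 0) := by
    refine hexp.bdd_mul (c := log 4 + 4)
      (Complex.measurable_ofReal.comp measurable_psiRatio).aestronglyMeasurable ?_
    refine Eventually.of_forall fun u ↦ ?_
    rw [Complex.norm_real, norm_of_nonneg (psiRatio_nonneg u)]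
    exact psiRatio_le u
  have hsplit : ∫ u in Set.Ioi (0 : ℝ), (psiError u : ℂ) * Complex.exp (-a * u) =
      (∫ u in Set.Ioi (0 : ℝ), (psiRatio u : ℂ) * Complex.exp (-a * u)) - 1 / a := by
    have h1 : ∫ u in Set.Ioi (0 : ℝ), Complex.exp (-a * u) = 1 / a := by
      rw [integral_exp_mul_complex_Ioi hre]
      simp [neg_div]
    rw [← h1, ← integral_sub hratio hexp]
    refine setIntegral_congr_fun measurableSet_Ioi fun u hu ↦ ?_
    simp only [psiError, Set.indicator_of_mem hu, Pi.one_apply]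
    push_cast
    ring
  have hL := LSeries_vonMangoldt_eq_mul_integral hs1
  rw [show s - 1 = a by rw [hs]; ring] at hL
  have hres : ∀ n : ℕ, ArithmeticFunction.vonMangoldt.residueClass (1 : ZMod 1) n =
      ArithmeticFunction.vonMangoldt n := fun n ↦ by
    rw [ArithmeticFunction.vonMangoldt.residueClass, Set.indicator_of_mem]
    exact Subsingleton.elim _ _
  have hA := ArithmeticFunction.vonMangoldt.eqOn_LFunctionResidueClassAux
    (isUnit_one (M := ZMod 1)) (show s ∈ {s : ℂ | 1 < s.re} from hs1)
  simp only [hres, Nat.totient_one, Nat.cast_one, inv_one] at hA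
  rw [hint, hsplit, show 1 + (ε : ℂ) + τ * Complex.I = s by rw [hs, ha]; ring, psiTransform, hA, hL,
    show s - 1 = a by rw [hs]; ring]
  field_simp
  rw [hs]
  ring

end PsiTransform

section WienerIkehara

open MeasureTheory

lemma psiError_smoothing_eq {h ε : ℝ} (hh : 0 < h) (hε : 0 < ε) (w : ℝ) :
    ((∫ y, psiError (w - h * y) * exp (-ε * (w - h * y)) * fejer y : ℝ) : ℂ) =
      (h : ℂ)⁻¹ * ∫ t, (triangle t : ℂ) * Complex.exp (Complex.I * (w / h : ℝ) * t) *
        psiTransform (1 + ε + (t / h : ℝ) * Complex.I) := by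
  set a : ℝ → ℝ := fun y ↦ psiError (w - h * y) * exp (-ε * (w - h * y)) with ha
  have ha_int : Integrable a := by
    have h1 := (integrable_psiError_mul_exp hε).comp_sub_left w
    exact h1.comp_mul_left' hh.ne'
  set F : ℝ → ℝ → ℂ := fun y t ↦
    (a y : ℂ) * ((triangle t : ℂ) * Complex.exp (Complex.I * y * t)) with hF
  have hF_int : Integrable (Function.uncurry F) (volume.prod volume) := by
    have h1 := ha_int.ofReal (𝕜 := ℂ) |>.mul_prod (integrable_triangle.ofReal (𝕜 := ℂ))
    refine (h1.bdd_mul (c := 1) (f := fun z : ℝ × ℝ ↦ Complex.exp (Complex.I * z.1 * z.2))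
      (by fun_prop) (Eventually.of_forall fun z ↦ ?_)).congr (Eventually.of_forall fun z ↦ ?_)
    · rw [Complex.norm_exp]
      simp
    · simp only [Function.uncurry, hF, RCLike.ofReal, Complex.coe_algebraMap]
      ring_nf
  have hleft : ((∫ y, a y * fejer y : ℝ) : ℂ) = ∫ y, ∫ t, F y t := by
    rw [← integral_complex_ofReal]
    refine integral_congr_ae (Eventually.of_forall fun y ↦ ?_)
    simp only [hF, integral_const_mul, integral_triangle_mul_cexp]
    push_cast
    rfl
  rw [hleft, integral_integral_swap hF_int, ← integral_const_mul]
  refine integral_congr_ae (Eventually.of_forall fun t ↦ ?_)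
  simp only
  set g : ℝ → ℂ := fun u ↦ (psiError u : ℂ) * Complex.exp (-(ε + (t / h : ℝ) * Complex.I) * u)
    with hg
  have hFg (y : ℝ) : F y t =
      (triangle t : ℂ) * Complex.exp (Complex.I * (w / h : ℝ) * t) * g (w - h * y) := by
    have : Complex.exp (Complex.I * (w / h : ℝ) * t) *
        Complex.exp (-(ε + (t / h : ℝ) * Complex.I) * (w - h * y : ℝ)) =
        (exp (-ε * (w - h * y)) : ℝ) * Complex.exp (Complex.I * y * t) := by
      have hh' : (h : ℂ) ≠ 0 := by exact_mod_cast hh.ne'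
      rw [Complex.ofReal_exp, ← Complex.exp_add, ← Complex.exp_add]
      congr 1
      push_cast
      field_simp
      ring
    simp only [hF, hg, ha]
    rw [Complex.ofReal_mul]
    linear_combination (-((triangle t : ℂ) * (psiError (w - h * y) : ℂ))) * this
  have hgint : ∫ y, g (w - h * y) = (h : ℂ)⁻¹ * psiTransform (1 + ε + (t / h : ℝ) * Complex.I) := by
    rw [Measure.integral_comp_mul_left (fun z ↦ g (w - z)) h, integral_sub_left_eq_self g volume w,
      integral_psiError_mul_cexp hε, abs_of_pos (inv_pos.mpr hh), Complex.real_smul]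
    push_cast
    rfl
  simp only [hFg, integral_const_mul, hgint]
  ring

lemma psiError_smoothing_eq_boundary {h : ℝ} (hh : 0 < h) (w : ℝ) :
    ((∫ y, psiError (w - h * y) * fejer y : ℝ) : ℂ) =
      (h : ℂ)⁻¹ * ∫ t, (triangle t : ℂ) * Complex.exp (Complex.I * (w / h : ℝ) * t) *
        psiTransform (1 + (t / h : ℝ) * Complex.I) := by
  have hleft : Tendsto
      (fun ε : ℝ ↦ ((∫ y, psiError (w - h * y) * exp (-ε * (w - h * y)) * fejer y : ℝ) : ℂ))
      (nhdsWithin 0 (Set.Ioi 0)) (nhds ((∫ y, psiError (w - h * y) * fejer y : ℝ) : ℂ)) := by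
    refine (Complex.continuous_ofReal.tendsto _).comp ?_
    refine tendsto_integral_filter_of_dominated_convergence
      (fun y ↦ (log 4 + 5) * fejer y) ?_ ?_ (integrable_fejer.const_mul _) ?_
    · refine Eventually.of_forall fun ε ↦ Measurable.aestronglyMeasurable ?_
      exact ((measurable_psiError.comp (by fun_prop)).mul (by fun_prop)).mul
        continuous_fejer.measurable
    · filter_upwards [self_mem_nhdsWithin] with ε hε
      refine Eventually.of_forall fun y ↦ ?_
      rw [norm_mul, norm_of_nonneg (fejer_nonneg y)]
      refine mul_le_mul_of_nonneg_right ?_ (fejer_nonneg y)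
      rcases le_or_gt (w - h * y) 0 with hu | hu
      · rw [psiError_of_nonpos hu]
        have : 0 ≤ log 4 := log_nonneg (by norm_num)
        simp
        linarith
      · rw [norm_mul, norm_of_nonneg (exp_pos _).le]
        refine (mul_le_of_le_one_right (norm_nonneg _) ?_).trans (abs_psiError_le _)
        rw [exp_le_one_iff]
        nlinarith [Set.mem_Ioi.mp hε]
    · refine Eventually.of_forall fun y ↦ ?_
      have : Continuous fun ε : ℝ ↦ psiError (w - h * y) * exp (-ε * (w - h * y)) * fejer y := by
        fun_prop
      simpa using (this.tendsto 0).mono_left nhdsWithin_le_nhds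
  have hright : Tendsto
      (fun ε : ℝ ↦ (h : ℂ)⁻¹ * ∫ t, (triangle t : ℂ) *
        Complex.exp (Complex.I * (w / h : ℝ) * t) *
        psiTransform (1 + ε + (t / h : ℝ) * Complex.I))
      (nhdsWithin 0 (Set.Ioi 0)) (nhds ((h : ℂ)⁻¹ * ∫ t, (triangle t : ℂ) *
        Complex.exp (Complex.I * (w / h : ℝ) * t) *
        psiTransform (1 + (t / h : ℝ) * Complex.I))) := by
    refine Tendsto.const_mul _ ?_
    obtain ⟨C, hC⟩ : ∃ C, ∀ p ∈ Set.Icc (0 : ℝ) 1 ×ˢ Set.Icc (-1 : ℝ) 1,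
        ‖psiTransform (1 + p.1 + (p.2 / h : ℝ) * Complex.I)‖ ≤ C := by
      refine (isCompact_Icc.prod isCompact_Icc).exists_bound_of_continuousOn ?_
      refine continuousOn_psiTransform.comp (by fun_prop) fun p hp ↦ ?_
      simpa using hp.1.1
    have hcont {ε : ℝ} (hε : 0 ≤ ε) :
        Continuous fun t : ℝ ↦ psiTransform (1 + ε + (t / h : ℝ) * Complex.I) := by
      refine continuousOn_psiTransform.comp_continuous (by fun_prop) fun τ ↦ ?_
      simpa using hε
    refine tendsto_integral_filter_of_dominated_convergence
      (fun t ↦ triangle t * C) ?_ ?_ (integrable_triangle.mul_const _) ?_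
    · filter_upwards [self_mem_nhdsWithin] with ε hε
      have := hcont (Set.mem_Ioi.mp hε).le
      have := continuous_triangle
      exact Continuous.aestronglyMeasurable (by fun_prop)
    · filter_upwards [Ioo_mem_nhdsGT zero_lt_one] with ε hε
      refine Eventually.of_forall fun t ↦ ?_
      have he : ‖Complex.exp (Complex.I * (w / h : ℝ) * t)‖ = 1 := by
        rw [Complex.norm_exp]
        simp
      rw [norm_mul, norm_mul, he, mul_one, Complex.norm_real, norm_of_nonneg (triangle_nonneg t)]
      rcases le_or_gt 1 |t| with ht | ht
      · simp [triangle_eq_zero ht]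
      · refine mul_le_mul_of_nonneg_left ?_ (triangle_nonneg t)
        exact hC (ε, t) ⟨⟨hε.1.le, hε.2.le⟩, (abs_lt.mp ht).1.le, (abs_lt.mp ht).2.le⟩
    · refine Eventually.of_forall fun t ↦ Tendsto.const_mul _ ?_
      have h1 : Tendsto (fun ε : ℝ ↦ (1 + ε + (t / h : ℝ) * Complex.I : ℂ))
          (nhdsWithin 0 (Set.Ioi 0))
          (nhdsWithin (1 + (t / h : ℝ) * Complex.I) {s | 1 ≤ s.re}) := by
        refine tendsto_nhdsWithin_iff.mpr ⟨?_, ?_⟩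
        · have : Continuous fun ε : ℝ ↦ (1 + ε + (t / h : ℝ) * Complex.I : ℂ) := by fun_prop
          simpa using (this.tendsto 0).mono_left nhdsWithin_le_nhds
        · filter_upwards [self_mem_nhdsWithin] with ε hε
          simpa using (Set.mem_Ioi.mp hε).le
      exact (continuousOn_psiTransform _ (by simp)).tendsto.comp h1
  refine tendsto_nhds_unique hleft (hright.congr' ?_)
  filter_upwards [self_mem_nhdsWithin] with ε hε
  exact (psiError_smoothing_eq hh hε w).symm

lemma tendsto_psiError_smoothing {h : ℝ} (hh : 0 < h) :
    Tendsto (fun w ↦ ∫ y, psiError (w - h * y) * fejer y) atTop (nhds 0) := by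
  have hRL := Real.tendsto_integral_exp_smul_cocompact
    fun t ↦ (triangle t : ℂ) * psiTransform (1 + (t / h : ℝ) * Complex.I)
  have hv : Tendsto (fun w : ℝ ↦ -(w / (2 * π * h))) atTop (cocompact ℝ) :=
    (tendsto_neg_atTop_atBot.comp (tendsto_id.atTop_div_const (by positivity))).mono_right
      atBot_le_cocompact
  have hlim := (hRL.comp hv).const_mul (h : ℂ)⁻¹
  rw [mul_zero] at hlim
  have hC : Tendsto (fun w ↦ ((∫ y, psiError (w - h * y) * fejer y : ℝ) : ℂ)) atTop (nhds 0) := by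
    refine hlim.congr fun w ↦ ?_
    rw [psiError_smoothing_eq_boundary hh, Function.comp_apply]
    congr 1
    refine integral_congr_ae (Eventually.of_forall fun t ↦ ?_)
    simp only [Circle.smul_def, fourierChar_apply, smul_eq_mul]
    rw [show (2 * π * -(t * -(w / (2 * π * h))) : ℝ) = w / h * t by field_simp]
    push_cast
    rw [show (w / h * t * Complex.I : ℂ) = Complex.I * (w / h) * t by ring]
    ring
  have := (Complex.continuous_re.tendsto 0).comp hC
  simpa [Function.comp_def] using this

lemma integrable_psiRatio_mul_fejer (w h : ℝ) :
    Integrable fun y ↦ psiRatio (w - h * y) * fejer y := by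
  refine integrable_fejer.bdd_mul (c := log 4 + 4)
    (measurable_psiRatio.comp (by fun_prop)).aestronglyMeasurable
    (Eventually.of_forall fun y ↦ ?_)
  rw [norm_of_nonneg (psiRatio_nonneg _)]
  exact psiRatio_le _

lemma tendsto_psiRatio_smoothing {h : ℝ} (hh : 0 < h) :
    Tendsto (fun w ↦ ∫ y, psiRatio (w - h * y) * fejer y) atTop (nhds (∫ y, fejer y)) := by
  have hmeas (w : ℝ) : Measurable fun y ↦ (Set.Ioi (0 : ℝ)).indicator (1 : ℝ → ℝ) (w - h * y) :=
    (measurable_one.indicator measurableSet_Ioi).comp (by fun_prop)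
  have hbound (w y : ℝ) :
      ‖(Set.Ioi (0 : ℝ)).indicator (1 : ℝ → ℝ) (w - h * y) * fejer y‖ ≤ fejer y := by
    rw [norm_mul, norm_of_nonneg (fejer_nonneg y)]
    refine mul_le_of_le_one_left (fejer_nonneg y) ?_
    by_cases hu : w - h * y ∈ Set.Ioi (0 : ℝ) <;> simp [Set.indicator, hu]
  have hind : Tendsto
      (fun w ↦ ∫ y, (Set.Ioi (0 : ℝ)).indicator (1 : ℝ → ℝ) (w - h * y) * fejer y) atTop
      (nhds (∫ y, fejer y)) := by
    refine tendsto_integral_filter_of_dominated_convergence fejer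
      (Eventually.of_forall fun w ↦ ((hmeas w).mul continuous_fejer.measurable).aestronglyMeasurable)
      (Eventually.of_forall fun w ↦ Eventually.of_forall (hbound w)) integrable_fejer
      (Eventually.of_forall fun y ↦ tendsto_const_nhds.congr' ?_)
    filter_upwards [eventually_gt_atTop (h * y)] with w hw
    rw [Set.indicator_of_mem (Set.mem_Ioi.mpr (sub_pos.mpr hw)), Pi.one_apply, one_mul]
  have hsum := (tendsto_psiError_smoothing hh).add hind
  rw [zero_add] at hsum
  refine hsum.congr fun w ↦ ?_
  have hi : Integrable fun y ↦ (Set.Ioi (0 : ℝ)).indicator (1 : ℝ → ℝ) (w - h * y) * fejer y :=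
    integrable_fejer.mono' ((hmeas w).mul continuous_fejer.measurable).aestronglyMeasurable
      (Eventually.of_forall (hbound w))
  have he : (fun y ↦ psiError (w - h * y) * fejer y) = fun y ↦ psiRatio (w - h * y) * fejer y -
      (Set.Ioi (0 : ℝ)).indicator (1 : ℝ → ℝ) (w - h * y) * fejer y := by
    funext y
    simp only [psiError]
    ring
  rw [he, integral_sub (integrable_psiRatio_mul_fejer w h) hi, sub_add_cancel]

end WienerIkehara

section PrimeNumberTheorem

open MeasureTheory Chebyshev

lemma tendsto_setIntegral_fejer :
    Tendsto (fun M : ℝ ↦ ∫ y in Set.Ioc (-M) M, fejer y) atTop (nhds (∫ y, fejer y)) := by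
  refine (intervalIntegral_tendsto_integral integrable_fejer tendsto_neg_atTop_atBot
    tendsto_id).congr' ?_
  filter_upwards [eventually_ge_atTop 0] with M hM
  simp only [id]
  rw [intervalIntegral.integral_of_le (by linarith)]

lemma psiRatio_le_smoothing {h : ℝ} (hh : 0 < h) (M w : ℝ) :
    psiRatio w * exp (-(2 * h * M)) * ∫ y in Set.Ioc (-M) M, fejer y ≤
      ∫ y, psiRatio (w + h * M - h * y) * fejer y := by
  have hi := integrable_psiRatio_mul_fejer (w + h * M) h
  refine le_trans ?_ (setIntegral_le_integral (s := Set.Ioc (-M) M) hi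
    (Eventually.of_forall fun y ↦ mul_nonneg (psiRatio_nonneg _) (fejer_nonneg y)))
  rw [← integral_const_mul]
  refine setIntegral_mono_on (integrable_fejer.const_mul _).integrableOn hi.integrableOn
    measurableSet_Ioc fun y hy ↦ mul_le_mul_of_nonneg_right ?_ (fejer_nonneg y)
  have hwv : w ≤ w + h * M - h * y := by nlinarith [hy.2]
  refine le_trans ?_ (psiRatio_ge_mul_exp hwv)
  gcongr
  · exact psiRatio_nonneg w
  · nlinarith [hy.1]

lemma smoothing_le_psiRatio {h : ℝ} (hh : 0 < h) (M w : ℝ) :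
    ∫ y, psiRatio (w - h * M - h * y) * fejer y ≤
      exp (2 * h * M) * psiRatio w * (∫ y in Set.Ioc (-M) M, fejer y) +
        (log 4 + 4) * ((∫ y, fejer y) - ∫ y in Set.Ioc (-M) M, fejer y) := by
  have hi := integrable_psiRatio_mul_fejer (w - h * M) h
  rw [← integral_add_compl (s := Set.Ioc (-M) M) measurableSet_Ioc hi,
    ← integral_add_compl (s := Set.Ioc (-M) M) measurableSet_Ioc integrable_fejer,
    add_sub_cancel_left, ← integral_const_mul, ← integral_const_mul]
  refine add_le_add ?_ ?_
  · refine setIntegral_mono_on hi.integrableOn (integrable_fejer.const_mul _).integrableOn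
      measurableSet_Ioc fun y hy ↦ mul_le_mul_of_nonneg_right ?_ (fejer_nonneg y)
    set v := w - h * M - h * y with hv
    have hvw : v ≤ w := by nlinarith [hy.1]
    calc psiRatio v = exp (w - v) * (psiRatio v * exp (v - w)) := by
          rw [mul_left_comm, ← exp_add, sub_add_sub_cancel, sub_self, exp_zero, mul_one]
      _ ≤ exp (2 * h * M) * psiRatio w := by
          gcongr
          · exact mul_nonneg (psiRatio_nonneg v) (exp_pos _).le
          · nlinarith [hy.2]
          · exact psiRatio_ge_mul_exp hvw
  · exact setIntegral_mono hi.integrableOn (integrable_fejer.const_mul _).integrableOn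
      fun y ↦ mul_le_mul_of_nonneg_right (psiRatio_le _) (fejer_nonneg y)

/-- The **prime number theorem** in the form `ψ(e^u) / e^u → 1`. -/
theorem tendsto_psiRatio : Tendsto psiRatio atTop (nhds 1) := by
  set c := ∫ y, fejer y with hc
  have hc0 : 0 < c := integral_fejer_pos
  have hcM := tendsto_setIntegral_fejer
  rw [← hc] at hcM
  have hexp (s M : ℝ) : Tendsto (fun h : ℝ ↦ exp (s * h * M)) (nhdsWithin 0 (Set.Ioi 0))
      (nhds 1) := by
    have : Continuous fun h : ℝ ↦ exp (s * h * M) := by fun_prop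
    simpa using (this.tendsto 0).mono_left nhdsWithin_le_nhds
  rw [tendsto_order]
  constructor
  · intro l hl
    have h1 : Tendsto (fun M : ℝ ↦ (c - (log 4 + 4) * (c - ∫ y in Set.Ioc (-M) M, fejer y)) /
        ∫ y in Set.Ioc (-M) M, fejer y) atTop (nhds 1) := by
      have := ((((hcM.const_sub c).const_mul (log 4 + 4)).const_sub c).div hcM hc0.ne')
      simpa [hc0.ne', Pi.div_def] using this
    obtain ⟨M, hM, hMpos⟩ := ((h1.eventually_const_lt hl).and (hcM.eventually_const_lt hc0)).exists
    have h2 := (hexp (-2) M).mul_const ((c - (log 4 + 4) * (c - ∫ y in Set.Ioc (-M) M, fejer y)) /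
        ∫ y in Set.Ioc (-M) M, fejer y)
    rw [one_mul] at h2
    obtain ⟨h, hh, hpos⟩ := ((h2.eventually_const_lt hM).and self_mem_nhdsWithin).exists
    replace hpos : 0 < h := hpos
    have h3 := (tendsto_psiRatio_smoothing hpos).comp
      (tendsto_atTop_add_const_right atTop (-(h * M)) tendsto_id)
    have h4 := (((h3.sub_const ((log 4 + 4) * (c - ∫ y in Set.Ioc (-M) M, fejer y))).div_const
      (∫ y in Set.Ioc (-M) M, fejer y)).const_mul (exp (-2 * h * M)))
    filter_upwards [h4.eventually_const_lt hh] with w hw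
    refine hw.trans_le ?_
    have h5 := smoothing_le_psiRatio hpos M w
    simp only [Function.comp_apply, id, ← sub_eq_add_neg]
    rw [← mul_div_assoc, div_le_iff₀ hMpos]
    calc _ ≤ exp (-2 * h * M) *
          (exp (2 * h * M) * psiRatio w * ∫ y in Set.Ioc (-M) M, fejer y) := by
          gcongr
          linarith
      _ = exp (-2 * h * M + 2 * h * M) * (psiRatio w * ∫ y in Set.Ioc (-M) M, fejer y) := by
          rw [exp_add]
          ring
      _ = _ := by
          rw [show -2 * h * M + 2 * h * M = 0 by ring, exp_zero, one_mul]
  · intro r hr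
    have h1 : Tendsto (fun M : ℝ ↦ c / ∫ y in Set.Ioc (-M) M, fejer y) atTop (nhds 1) := by
      simpa [hc0.ne', Pi.div_def] using (tendsto_const_nhds (x := c)).div hcM hc0.ne'
    obtain ⟨M, hM, hMpos⟩ := ((h1.eventually_lt_const hr).and (hcM.eventually_const_lt hc0)).exists
    have h2 := (hexp 2 M).mul_const (c / ∫ y in Set.Ioc (-M) M, fejer y)
    rw [one_mul] at h2
    obtain ⟨h, hh, hpos⟩ := ((h2.eventually_lt_const hM).and self_mem_nhdsWithin).exists
    replace hpos : 0 < h := hpos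
    have h3 := (tendsto_psiRatio_smoothing hpos).comp
      (tendsto_atTop_add_const_right atTop (h * M) tendsto_id)
    have h4 := (h3.div_const (∫ y in Set.Ioc (-M) M, fejer y)).const_mul (exp (2 * h * M))
    filter_upwards [h4.eventually_lt_const hh] with w hw
    refine lt_of_le_of_lt ?_ hw
    have h5 := psiRatio_le_smoothing hpos M w
    simp only [Function.comp_apply, id]
    rw [← mul_div_assoc, le_div_iff₀ hMpos]
    calc _ = exp (2 * h * M) *
          (psiRatio w * exp (-(2 * h * M)) * ∫ y in Set.Ioc (-M) M, fejer y) := by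
          rw [exp_neg]
          field_simp
      _ ≤ _ := by gcongr

lemma tendsto_psi_div : Tendsto (fun x ↦ psi x / x) atTop (nhds 1) := by
  refine (tendsto_psiRatio.comp tendsto_log_atTop).congr' ?_
  filter_upwards [eventually_gt_atTop 0] with x hx
  rw [Function.comp_apply, psiRatio, exp_neg, exp_log hx, div_eq_mul_inv]

lemma tendsto_theta_div : Tendsto (fun x ↦ theta x / x) atTop (nhds 1) := by
  have h1 : Tendsto (fun x ↦ (psi - theta) x / x) atTop (nhds 0) := by
    refine (isBigO_psi_sub_theta_sqrt.trans_isLittleO ?_).tendsto_div_nhds_zero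
    refine Asymptotics.isLittleO_of_tendsto' ?_
      (tendsto_sqrt_atTop.inv_tendsto_atTop.congr fun x ↦ ?_)
    · filter_upwards [eventually_gt_atTop 0] with x hx h
      exact absurd h hx.ne'
    · rw [Pi.inv_apply, sqrt_div_self']
      exact (one_div _).symm
  have h2 := tendsto_psi_div.sub h1
  rw [sub_zero] at h2
  refine h2.congr fun x ↦ ?_
  rw [← sub_div, Pi.sub_apply, sub_sub_cancel]

/-- The **prime number theorem**. -/
theorem tendsto_primeCounting_mul_log_div :
    Tendsto (fun x : ℝ ↦ Nat.primeCounting ⌊x⌋₊ * log x / x) atTop (nhds 1) := by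
  have h1 : Tendsto (fun x : ℝ ↦ (Nat.primeCounting ⌊x⌋₊ - theta x / log x) / (x / log x)) atTop
      (nhds 0) := by
    refine (primeCounting_sub_theta_div_log_isBigO.trans_isLittleO ?_).tendsto_div_nhds_zero
    refine Asymptotics.isLittleO_of_tendsto' ?_ (tendsto_log_atTop.inv_tendsto_atTop.congr' ?_)
    · filter_upwards [eventually_gt_atTop 1] with x hx h
      have := log_pos hx
      exact absurd h (by positivity)
    · filter_upwards [eventually_gt_atTop 1] with x hx
      have := log_pos hx
      simp only [Pi.inv_apply]
      field_simp
  have h2 := h1.add tendsto_theta_div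
  rw [zero_add] at h2
  refine h2.congr' ?_
  filter_upwards [eventually_gt_atTop 1] with x hx
  have := log_pos hx
  field_simp
  ring

end PrimeNumberTheorem

section LogAsymptotics

variable {ι : Type*} {l : Filter ι} {f g : ι → ℝ}

lemma tendsto_log_div_log {c : ℝ} (hc : 0 < c) (hg : Tendsto g l atTop)
    (h : Tendsto (fun i ↦ f i / g i) l (nhds c)) :
    Tendsto (fun i ↦ log (f i) / log (g i)) l (nhds 1) := by
  have hlog := tendsto_log_atTop.comp hg
  have h1 := ((h.log hc.ne').div_atTop hlog).add_const 1
  rw [zero_add] at h1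
  refine h1.congr' ?_
  filter_upwards [hg.eventually_gt_atTop 0, hlog.eventually_gt_atTop 0,
    h.eventually_const_lt hc] with i hgi hli hfi
  have hfi0 : 0 < f i := (div_pos_iff_of_pos_right hgi).mp hfi
  rw [Function.comp_apply] at hli ⊢
  rw [log_div hfi0.ne' hgi.ne', div_add_one hli.ne', sub_add_cancel]

lemma tendsto_log_div_self : Tendsto (fun x : ℝ ↦ log x / x) atTop (nhds 0) :=
  isLittleO_log_id_atTop.tendsto_div_nhds_zero

lemma tendsto_div_log_atTop : Tendsto (fun x : ℝ ↦ x / log x) atTop atTop := by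
  have h : Tendsto (fun x : ℝ ↦ log x / x) atTop (nhdsWithin 0 (Set.Ioi 0)) := by
    refine tendsto_nhdsWithin_iff.mpr ⟨tendsto_log_div_self, ?_⟩
    filter_upwards [eventually_gt_atTop 1] with x hx
    exact div_pos (log_pos hx) (by linarith)
  exact h.inv_tendsto_nhdsGT_zero.congr fun x ↦ inv_div _ _

lemma tendsto_log_div_log_div_log :
    Tendsto (fun x : ℝ ↦ log (x / log x) / log x) atTop (nhds 1) := by
  have h := (tendsto_log_div_self.comp tendsto_log_atTop).const_sub 1
  rw [sub_zero] at h
  refine h.congr' ?_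
  filter_upwards [eventually_gt_atTop 1] with x hx
  have := log_pos hx
  rw [Function.comp_apply, log_div (by linarith) this.ne', sub_div, div_self this.ne']

lemma tendsto_log_log_rpow_div {a : ℝ} (ha : 0 < a) :
    Tendsto (fun x : ℝ ↦ log (log (x ^ a)) / log (log x)) atTop (nhds 1) := by
  refine tendsto_log_div_log ha tendsto_log_atTop (tendsto_const_nhds.congr' ?_)
  filter_upwards [eventually_gt_atTop 1] with x hx
  rw [log_rpow (by linarith), mul_div_cancel_right₀ _ (log_pos hx).ne']

end LogAsymptotics

section PrimeReciprocals

lemma tendsto_primeCounting_add_mul_log_div (c : ℝ) :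
    Tendsto (fun x : ℝ ↦ (Nat.primeCounting ⌊x⌋₊ + c) * log x / x) atTop (nhds 1) := by
  have h := tendsto_primeCounting_mul_log_div.add (tendsto_log_div_self.const_mul c)
  rw [mul_zero, add_zero] at h
  exact h.congr fun x ↦ by ring

lemma tendsto_log_primeCounting_div (c : ℝ) :
    Tendsto (fun x : ℝ ↦ log (Nat.primeCounting ⌊x⌋₊ + c) / log x) atTop (nhds 1) := by
  have h : Tendsto (fun x : ℝ ↦ (Nat.primeCounting ⌊x⌋₊ + c) / (x / log x)) atTop (nhds 1) :=
    (tendsto_primeCounting_add_mul_log_div c).congr fun x ↦ (div_div_eq_mul_div _ _ _).symm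
  have h1 := (tendsto_log_div_log one_pos tendsto_div_log_atTop h).mul tendsto_log_div_log_div_log
  rw [one_mul] at h1
  refine h1.congr' ?_
  filter_upwards [(tendsto_log_atTop.comp tendsto_div_log_atTop).eventually_gt_atTop 0] with x hx
  exact div_mul_div_cancel₀ hx.ne'

lemma tendsto_log_log_primeCounting_div (c : ℝ) :
    Tendsto (fun x : ℝ ↦ log (log (Nat.primeCounting ⌊x⌋₊ + c)) / log (log x)) atTop (nhds 1) :=
  tendsto_log_div_log one_pos tendsto_log_atTop (tendsto_log_primeCounting_div c)

lemma tendsto_nth_prime_atTop : Tendsto (fun k ↦ (Nat.nth Nat.Prime k : ℝ)) atTop atTop :=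
  tendsto_natCast_atTop_atTop.comp (Nat.nth_strictMono Nat.infinite_setOfPred_prime).tendsto_atTop

lemma primeCounting_nth_prime (k : ℕ) : Nat.primeCounting (Nat.nth Nat.Prime k) = k + 1 :=
  Nat.count_nth_succ_of_infinite Nat.infinite_setOfPred_prime k

lemma tendsto_mul_log_div_nth_prime :
    Tendsto (fun k : ℕ ↦ (k + 2 : ℝ) * log (k + 2) / Nat.nth Nat.Prime k) atTop (nhds 1) := by
  have h := ((tendsto_primeCounting_add_mul_log_div 1).comp tendsto_nth_prime_atTop).mul
    ((tendsto_log_primeCounting_div 1).comp tendsto_nth_prime_atTop)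
  rw [one_mul] at h
  refine h.congr' ?_
  filter_upwards [tendsto_nth_prime_atTop.eventually_gt_atTop 1] with k hk
  have hlog := log_pos hk
  have hcast : ((Nat.primeCounting (Nat.nth Nat.Prime k) : ℕ) : ℝ) + 1 = k + 2 := by
    rw [primeCounting_nth_prime]
    push_cast
    ring
  simp only [Function.comp_apply, Nat.floor_natCast, hcast]
  field_simp

lemma tendsto_log_log_sub_mul :
    Tendsto (fun k : ℕ ↦ (log (log ((k + 1 : ℕ) + 2)) - log (log ((k : ℝ) + 2))) *
      (((k : ℝ) + 2) * log (k + 2))) atTop (nhds 1) := by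
  have hx : Tendsto (fun k : ℕ ↦ (k : ℝ) + 2) atTop atTop :=
    tendsto_atTop_add_const_right _ _ tendsto_natCast_atTop_atTop
  have hu : Tendsto (fun k : ℕ ↦ ((k : ℝ) + 2) * log (1 + 1 / (k + 2))) atTop (nhds 1) :=
    (tendsto_mul_log_one_add_div_atTop 1).comp hx
  have hratio : Tendsto (fun k : ℕ ↦ ((k : ℝ) + 2) / (k + 3)) atTop (nhds 1) := by
    have h3 : Tendsto (fun k : ℕ ↦ (k : ℝ) + 3) atTop atTop :=
      tendsto_atTop_add_const_right _ _ tendsto_natCast_atTop_atTop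
    have h := (h3.inv_tendsto_atTop).const_sub 1
    rw [sub_zero] at h
    refine h.congr fun k ↦ ?_
    have : (k : ℝ) + 3 ≠ 0 := by positivity
    rw [Pi.inv_apply]
    field_simp
    ring
  have hl : Tendsto (fun k : ℕ ↦ ((k : ℝ) + 2) * log (1 + 1 / (k + 2)) *
      (log (k + 2) / log (k + 3))) atTop (nhds 1) := by
    have h := hu.mul (tendsto_log_div_log one_pos
      (tendsto_atTop_add_const_right _ _ tendsto_natCast_atTop_atTop) hratio)
    rwa [one_mul] at h
  have key : ∀ k : ℕ, log (1 + 1 / ((k : ℝ) + 2)) = log (k + 3) - log (k + 2) := fun k ↦ by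
    rw [← log_div (by positivity) (by positivity)]
    congr 1
    field_simp
    ring
  have hcast : ∀ k : ℕ, (((k + 1 : ℕ) : ℝ) + 2) = k + 3 := fun k ↦ by
    push_cast
    ring
  refine tendsto_of_tendsto_of_tendsto_of_le_of_le hl hu (fun k ↦ ?_) fun k ↦ ?_
  all_goals
    have hk : (0 : ℝ) ≤ k := Nat.cast_nonneg k
    have h2 : 0 < log ((k : ℝ) + 2) := log_pos (by linarith)
    have h3 : 0 < log ((k : ℝ) + 3) := log_pos (by linarith)
    simp only [key, hcast]
    rw [← log_div h3.ne' h2.ne']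
  · have h := one_sub_inv_le_log_of_pos (div_pos h3 h2)
    calc ((k : ℝ) + 2) * (log (k + 3) - log (k + 2)) * (log (k + 2) / log (k + 3))
        = (1 - (log (k + 3) / log ((k : ℝ) + 2))⁻¹) * ((k + 2) * log (k + 2)) := by
          field_simp
      _ ≤ _ := by gcongr
  · have h := log_le_sub_one_of_pos (div_pos h3 h2)
    calc log (log (k + 3) / log ((k : ℝ) + 2)) * ((k + 2) * log (k + 2))
        ≤ (log (k + 3) / log ((k : ℝ) + 2) - 1) * ((k + 2) * log (k + 2)) := by gcongr
      _ = _ := by field_simp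

lemma tendsto_log_log_natCast_add_two :
    Tendsto (fun n : ℕ ↦ log (log ((n : ℝ) + 2))) atTop atTop :=
  tendsto_log_atTop.comp <| tendsto_log_atTop.comp <|
    tendsto_atTop_add_const_right _ _ tendsto_natCast_atTop_atTop

lemma tendsto_sum_inv_nth_prime_div :
    Tendsto (fun n : ℕ ↦ (∑ k ∈ Finset.range n, (Nat.nth Nat.Prime k : ℝ)⁻¹) /
      log (log (n + 2))) atTop (nhds 1) := by
  set b : ℕ → ℝ := fun k ↦ log (log ((k + 1 : ℕ) + 2)) - log (log ((k : ℝ) + 2)) with hb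
  have hbpos : ∀ k, 0 < b k := fun k ↦ by
    have hk : (0 : ℝ) ≤ k := Nat.cast_nonneg k
    have h2 : 0 < log ((k : ℝ) + 2) := log_pos (by linarith)
    refine sub_pos.mpr (log_lt_log h2 (log_lt_log (by linarith) ?_))
    push_cast
    linarith
  have hsum : ∀ n, ∑ k ∈ Finset.range n, b k = log (log ((n : ℝ) + 2)) - log (log 2) := fun n ↦ by
    rw [hb, Finset.sum_range_sub (fun k : ℕ ↦ log (log ((k : ℝ) + 2)))]
    simp
  have ho : (fun k ↦ (Nat.nth Nat.Prime k : ℝ)⁻¹ - b k) =o[atTop] b := by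
    refine Asymptotics.isLittleO_of_tendsto (fun k h ↦ absurd h (hbpos k).ne') ?_
    have h := (tendsto_mul_log_div_nth_prime.div tendsto_log_log_sub_mul one_ne_zero).sub_const 1
    rw [div_one, sub_self] at h
    refine h.congr fun k ↦ ?_
    have hk : (0 : ℝ) ≤ k := Nat.cast_nonneg k
    have h2 : 0 < log ((k : ℝ) + 2) := log_pos (by linarith)
    have hbk := hbpos k
    have hq : (0 : ℝ) < Nat.nth Nat.Prime k := by exact_mod_cast (Nat.prime_nth_prime k).pos
    simp only [Pi.div_apply]
    change _ / (b k * _) - 1 = _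
    field_simp
  have hdiv : Tendsto (fun n ↦ ∑ k ∈ Finset.range n, b k) atTop atTop := by
    simp only [hsum]
    exact tendsto_atTop_add_const_right _ _ tendsto_log_log_natCast_add_two
  have h1 := (ho.sum_range (fun k ↦ (hbpos k).le) hdiv).tendsto_div_nhds_zero.add_const 1
  have h2 : Tendsto (fun n : ℕ ↦ (∑ k ∈ Finset.range n, b k) / log (log ((n : ℝ) + 2))) atTop
      (nhds 1) := by
    have h := ((tendsto_const_nhds (x := log (log 2))).div_atTop
      tendsto_log_log_natCast_add_two).const_sub 1
    rw [sub_zero] at h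
    refine h.congr' ?_
    filter_upwards [tendsto_log_log_natCast_add_two.eventually_gt_atTop 0] with n hn
    rw [hsum, sub_div, div_self hn.ne']
  have h3 := h1.mul h2
  rw [zero_add, one_mul] at h3
  refine h3.congr' ?_
  filter_upwards [hdiv.eventually_gt_atTop 0] with n hn
  rw [div_add_one hn.ne', Finset.sum_sub_distrib, sub_add_cancel, div_mul_div_cancel₀ hn.ne']

lemma sum_primesLE_inv (n : ℕ) :
    ∑ p ∈ Nat.primesLE n, (p : ℝ)⁻¹ =
      ∑ k ∈ Finset.range (Nat.primeCounting n), (Nat.nth Nat.Prime k : ℝ)⁻¹ := by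
  symm
  refine Finset.sum_nbij (Nat.nth Nat.Prime) (fun k hk ↦ ?_)
    (Nat.nth_injective Nat.infinite_setOfPred_prime).injOn (fun p hp ↦ ?_) fun _ _ ↦ rfl
  · rw [Nat.mem_primesLE]
    refine ⟨Nat.lt_succ_iff.mp (Nat.nth_lt_of_lt_count ?_), Nat.prime_nth_prime k⟩
    exact Finset.mem_range.mp hk
  · rw [Finset.mem_coe, Nat.mem_primesLE] at hp
    refine ⟨Nat.count Nat.Prime p, ?_, Nat.nth_count hp.2⟩
    rw [Finset.coe_range, Set.mem_Iio]
    exact Nat.count_strict_mono hp.2 (Nat.lt_succ_iff.mpr hp.1)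

lemma tendsto_sum_inv_primesLE_div :
    Tendsto (fun x : ℝ ↦ (∑ p ∈ Nat.primesLE ⌊x⌋₊, (p : ℝ)⁻¹) / log (log x)) atTop (nhds 1) := by
  have hpi : Tendsto (fun x : ℝ ↦ Nat.primeCounting ⌊x⌋₊) atTop atTop :=
    Nat.tendsto_primeCounting.comp tendsto_nat_floor_atTop
  have h := (tendsto_sum_inv_nth_prime_div.comp hpi).mul (tendsto_log_log_primeCounting_div 2)
  rw [one_mul] at h
  refine h.congr' ?_
  filter_upwards [(tendsto_log_log_natCast_add_two.comp hpi).eventually_gt_atTop 0] with x hx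
  simp only [Function.comp_apply] at hx ⊢
  rw [sum_primesLE_inv, div_mul_div_cancel₀ hx.ne']

/-- A weak form of Mertens' second theorem, for primes up to a power of `x`. -/
lemma tendsto_sum_inv_primesLE_rpow_div {a : ℝ} (ha : 0 < a) :
    Tendsto (fun x : ℝ ↦ (∑ p ∈ Nat.primesLE ⌊x ^ a⌋₊, (p : ℝ)⁻¹) / log (log x)) atTop
      (nhds 1) := by
  have hx := tendsto_rpow_atTop ha
  have h := (tendsto_sum_inv_primesLE_div.comp hx).mul (tendsto_log_log_rpow_div ha)
  rw [one_mul] at h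
  refine h.congr' ?_
  filter_upwards [(tendsto_log_atTop.comp (tendsto_log_atTop.comp hx)).eventually_gt_atTop 0]
    with x hx
  exact div_mul_div_cancel₀ hx.ne'

end PrimeReciprocals

section SemiprimeCount

lemma semiprimeCount_le_sum (N : ℕ) :
    semiprimeCount N ≤ ∑ p ∈ Nat.primesLE (Nat.sqrt N), Nat.primeCounting (N / p) := by
  have hsub : (Finset.range (N + 1)).filter (fun m ↦ m.primeFactorsList.length = 2) ⊆
      (Nat.primesLE (Nat.sqrt N)).biUnion fun p ↦ (Nat.primesLE (N / p)).image (p * ·) := by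
    intro m hm
    rw [Finset.mem_filter, Finset.mem_range, List.length_eq_two] at hm
    obtain ⟨hmN, a, b, hab⟩ := hm
    have hm0 : m ≠ 0 := by
      rintro rfl
      simp at hab
    have ha : a.Prime := Nat.prime_of_mem_primeFactorsList (n := m) (by simp [hab])
    have hb : b.Prime := Nat.prime_of_mem_primeFactorsList (n := m) (by simp [hab])
    have hprod : a * b = m := by simpa [hab] using Nat.prod_primeFactorsList hm0
    have key : ∀ p q : ℕ, p.Prime → q.Prime → p ≤ q → p * q = m →
        m ∈ (Nat.primesLE (Nat.sqrt N)).biUnion fun p ↦ (Nat.primesLE (N / p)).image (p * ·) := by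
      intro p q hp hq hpq h
      have hN : p * q ≤ N := by omega
      simp only [Finset.mem_biUnion, Finset.mem_image, Nat.mem_primesLE]
      refine ⟨p, ⟨Nat.le_sqrt.mpr ((Nat.mul_le_mul_left p hpq).trans hN), hp⟩, q, ⟨?_, hq⟩, h⟩
      rw [Nat.le_div_iff_mul_le hp.pos, mul_comm]
      exact hN
    rcases le_total a b with h | h
    · exact key a b ha hb h hprod
    · exact key b a hb ha h (by rw [mul_comm, hprod])
  refine (Finset.card_le_card hsub).trans (Finset.card_biUnion_le.trans ?_)
  refine Finset.sum_le_sum fun p _ ↦ ?_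
  rw [← Nat.primesLE_card_eq_primeCounting]
  exact Finset.card_image_le

lemma sum_primeCounting_le_semiprimeCount_add (N y : ℕ) :
    ∑ p ∈ Nat.primesLE y, Nat.primeCounting (N / p) ≤ semiprimeCount N + y * y := by
  have hpi : Nat.primeCounting y ≤ y := by
    rw [← Nat.primesLE_card_eq_primeCounting, Nat.primesLE_eq_filter_Icc_one]
    simpa using Finset.card_filter_le (Finset.Icc 1 y) Nat.Prime
  have hcard : ∑ p ∈ Nat.primesLE y, (Nat.primesLE (N / p) \ Nat.primesLE y).card ≤
      semiprimeCount N := by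
    rw [← Finset.card_sigma, semiprimeCount]
    refine Finset.card_le_card_of_injOn (fun x ↦ x.1 * x.2) ?_ ?_
    · rintro ⟨p, q⟩ h
      simp only [Finset.coe_sigma, Set.mem_sigma_iff, Finset.mem_coe, Finset.mem_sdiff,
        Nat.mem_primesLE] at h
      obtain ⟨⟨-, hp⟩, ⟨hqN, hq⟩, -⟩ := h
      rw [Nat.le_div_iff_mul_le hp.pos, mul_comm] at hqN
      simp only [Finset.coe_filter, Finset.mem_range, Set.mem_ofPred_eq]
      refine ⟨by omega, ?_⟩
      rw [← ArithmeticFunction.cardFactors_apply]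
      exact (hp.mul_isAlmostPrime_two hq).2
    · rintro ⟨p, q⟩ h ⟨p', q'⟩ h' heq
      simp only [Finset.coe_sigma, Set.mem_sigma_iff, Finset.mem_coe, Finset.mem_sdiff,
        Nat.mem_primesLE, not_and] at h h' heq
      obtain ⟨⟨hpy, hp⟩, ⟨-, hq⟩, hqy⟩ := h
      obtain ⟨⟨hpy', hp'⟩, ⟨-, hq'⟩, hqy'⟩ := h'
      have hdvd : p ∣ p' * q' := heq ▸ dvd_mul_right p q
      rcases hp.dvd_mul.mp hdvd with hd | hd
      · obtain rfl := (Nat.prime_dvd_prime_iff_eq hp hp').mp hd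
        obtain rfl := Nat.eq_of_mul_eq_mul_left hp.pos heq
        rfl
      · obtain rfl := (Nat.prime_dvd_prime_iff_eq hp hq').mp hd
        exact absurd hp (hqy' hpy)
  calc ∑ p ∈ Nat.primesLE y, Nat.primeCounting (N / p)
      ≤ ∑ p ∈ Nat.primesLE y, ((Nat.primesLE (N / p) \ Nat.primesLE y).card + y) := by
        refine Finset.sum_le_sum fun p _ ↦ ?_
        rw [← Nat.primesLE_card_eq_primeCounting]
        refine Finset.card_le_card_sdiff_add_card.trans (Nat.add_le_add_left ?_ _)
        rwa [Nat.primesLE_card_eq_primeCounting]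
    _ ≤ semiprimeCount N + y * y := by
        rw [Finset.sum_add_distrib, Finset.sum_const, Nat.primesLE_card_eq_primeCounting,
          smul_eq_mul]
        exact add_le_add hcard (Nat.mul_le_mul_right y hpi)

end SemiprimeCount

section SemiprimeAsymptotics

lemma sqrt_le_div_of_mem_primesLE {N p : ℕ} (hp : p ∈ Nat.primesLE (Nat.sqrt N)) :
    √(N : ℝ) ≤ N / p := by
  rw [Nat.mem_primesLE] at hp
  have hp0 : (0 : ℝ) < p := by exact_mod_cast hp.2.pos
  have hps : (p : ℝ) ≤ √N := (Nat.cast_le.mpr hp.1).trans nat_sqrt_le_real_sqrt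
  rw [le_div_iff₀ hp0]
  calc √(N : ℝ) * p ≤ √N * √N := by gcongr
    _ = N := mul_self_sqrt (Nat.cast_nonneg N)

lemma eventually_forall_primesLE_sqrt {P : ℝ → Prop} (hP : ∀ᶠ x in atTop, P x) :
    ∀ᶠ N : ℕ in atTop, ∀ p ∈ Nat.primesLE (Nat.sqrt N), P (N / p) := by
  obtain ⟨X, hX⟩ := eventually_atTop.mp hP
  filter_upwards [(tendsto_sqrt_atTop.comp tendsto_natCast_atTop_atTop).eventually_ge_atTop X]
    with N hN p hp
  exact hX _ (hN.trans (sqrt_le_div_of_mem_primesLE hp))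

lemma floor_rpow_le_sqrt {a : ℝ} (ha : a ≤ 1 / 2) {N : ℕ} (hN : 1 ≤ N) :
    ⌊(N : ℝ) ^ a⌋₊ ≤ Nat.sqrt N := by
  rw [← nat_floor_real_sqrt_eq_nat_sqrt, sqrt_eq_rpow]
  exact Nat.floor_mono (rpow_le_rpow_of_exponent_le (by exact_mod_cast hN) ha)

lemma eventually_le_semiprimeCount {c : ℝ} (hc0 : 0 ≤ c) (hc : c < 1) :
    ∀ᶠ N : ℕ in atTop, c * (N / log N) * ∑ p ∈ Nat.primesLE ⌊(N : ℝ) ^ (1 / 4 : ℝ)⌋₊, (p : ℝ)⁻¹ ≤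
      semiprimeCount N + √N := by
  filter_upwards [eventually_forall_primesLE_sqrt
    (tendsto_primeCounting_mul_log_div.eventually_const_lt hc),
    eventually_forall_primesLE_sqrt (eventually_gt_atTop 1), eventually_ge_atTop 2] with N hN h1 hN2
  have hN1 : (1 : ℝ) < N := by exact_mod_cast hN2
  have hlog := log_pos hN1
  set y := ⌊(N : ℝ) ^ (1 / 4 : ℝ)⌋₊
  have hsub : Nat.primesLE y ⊆ Nat.primesLE (Nat.sqrt N) :=
    Nat.primesLE_mono (floor_rpow_le_sqrt (by norm_num) (by omega))
  have hyy : (y : ℝ) * y ≤ √N := by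
    have h : (y : ℝ) ≤ (N : ℝ) ^ (1 / 4 : ℝ) := Nat.floor_le (by positivity)
    calc (y : ℝ) * y ≤ (N : ℝ) ^ (1 / 4 : ℝ) * (N : ℝ) ^ (1 / 4 : ℝ) := by gcongr
      _ = √N := by
        rw [← rpow_add (by linarith), sqrt_eq_rpow]
        norm_num
  have hsum : (∑ p ∈ Nat.primesLE y, (Nat.primeCounting (N / p) : ℝ)) ≤
      semiprimeCount N + y * y := by
    exact_mod_cast sum_primeCounting_le_semiprimeCount_add N y
  refine le_trans ?_ (hsum.trans (add_le_add_right hyy _))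
  rw [Finset.mul_sum]
  refine Finset.sum_le_sum fun p hp ↦ ?_
  have hp0 : (1 : ℝ) ≤ p := by exact_mod_cast ((Nat.mem_primesLE.mp hp).2).one_lt.le
  have hx := h1 p (hsub hp)
  have hlx := log_pos hx
  have h := hN p (hsub hp)
  rw [Nat.floor_div_eq_div, lt_div_iff₀ (by linarith), ← div_lt_iff₀ hlx] at h
  refine le_trans ?_ h.le
  calc c * (N / log N) * (p : ℝ)⁻¹ = c * (N / p) / log N := by ring
    _ ≤ c * (N / p) / log (N / p) := by
      gcongr
      exact div_le_self (by linarith) hp0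

lemma eventually_semiprimeCount_le {δ : ℝ} (hδ : 0 < δ) (hδ' : δ < 1 / 2) :
    ∀ᶠ N : ℕ in atTop, (semiprimeCount N : ℝ) ≤ (1 + δ) * (N / log N) *
      ((1 - δ)⁻¹ * ∑ p ∈ Nat.primesLE ⌊(N : ℝ) ^ δ⌋₊, (p : ℝ)⁻¹ +
        2 * (∑ p ∈ Nat.primesLE ⌊(N : ℝ) ^ (1 / 2 : ℝ)⌋₊, (p : ℝ)⁻¹ -
          ∑ p ∈ Nat.primesLE ⌊(N : ℝ) ^ δ⌋₊, (p : ℝ)⁻¹)) := by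
  filter_upwards [eventually_forall_primesLE_sqrt
    (tendsto_primeCounting_mul_log_div.eventually_lt_const (show 1 < 1 + δ by linarith)),
    eventually_forall_primesLE_sqrt (eventually_gt_atTop 1), eventually_ge_atTop 2] with N hN h1 hN2
  have hN1 : (1 : ℝ) < N := by exact_mod_cast hN2
  have hlog := log_pos hN1
  rw [← sqrt_eq_rpow, nat_floor_real_sqrt_eq_nat_sqrt]
  set z := ⌊(N : ℝ) ^ δ⌋₊
  have hsub : Nat.primesLE z ⊆ Nat.primesLE (Nat.sqrt N) :=
    Nat.primesLE_mono (floor_rpow_le_sqrt hδ'.le (by omega))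
  have key : ∀ c : ℝ, 0 < c → ∀ p ∈ Nat.primesLE (Nat.sqrt N), c * log N ≤ log (N / p) →
      (Nat.primeCounting (N / p) : ℝ) ≤ (1 + δ) * (N / log N) * (c⁻¹ * (p : ℝ)⁻¹) := by
    intro c hc p hp hle
    have hx := h1 p hp
    have h := hN p hp
    rw [Nat.floor_div_eq_div, div_lt_iff₀ (by linarith), ← lt_div_iff₀ (log_pos hx)] at h
    refine h.le.trans ?_
    calc (1 + δ) * (N / p) / log (N / p) ≤ (1 + δ) * (N / p) / (c * log N) := by gcongr
      _ = _ := by ring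
  have hT : (semiprimeCount N : ℝ) ≤
      ∑ p ∈ Nat.primesLE (Nat.sqrt N), (Nat.primeCounting (N / p) : ℝ) := by
    exact_mod_cast semiprimeCount_le_sum N
  refine hT.trans ?_
  rw [← Finset.sum_sdiff hsub, ← Finset.sum_sdiff hsub, add_sub_cancel_right, mul_add, add_comm]
  rw [Finset.mul_sum, Finset.mul_sum, Finset.mul_sum, Finset.mul_sum]
  refine add_le_add (Finset.sum_le_sum fun p hp ↦ ?_) (Finset.sum_le_sum fun p hp ↦ ?_)
  · have hpm := Nat.mem_primesLE.mp hp
    have hp0 : (0 : ℝ) < p := by exact_mod_cast hpm.2.pos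
    have hpz : log p ≤ δ * log N := by
      rw [← log_rpow (by linarith)]
      exact log_le_log hp0 ((Nat.cast_le.mpr hpm.1).trans (Nat.floor_le (by positivity)))
    refine key _ (by linarith) p (hsub hp) ?_
    rw [log_div (by linarith) hp0.ne']
    linarith
  · have hps := (Finset.mem_sdiff.mp hp).1
    have h := key (1 / 2) (by norm_num) p hps ?_
    · simpa using h
    · rw [one_div_mul_eq_div, ← log_sqrt (by linarith)]
      exact log_le_log (sqrt_pos.mpr (by linarith)) (sqrt_le_div_of_mem_primesLE hps)

lemma tendsto_semiprimeCount_mul_log_div :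
    Tendsto (fun N : ℕ ↦ semiprimeCount N * log N / (N * log (log N))) atTop (nhds 1) := by
  have hA {a : ℝ} (ha : 0 < a) : Tendsto (fun N : ℕ ↦
      (∑ p ∈ Nat.primesLE ⌊(N : ℝ) ^ a⌋₊, (p : ℝ)⁻¹) / log (log N)) atTop (nhds 1) :=
    (tendsto_sum_inv_primesLE_rpow_div ha).comp tendsto_natCast_atTop_atTop
  have hll : ∀ᶠ N : ℕ in atTop, 0 < log (log (N : ℝ)) :=
    ((tendsto_log_atTop.comp tendsto_log_atTop).comp
      tendsto_natCast_atTop_atTop).eventually_gt_atTop 0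
  have hl : ∀ᶠ N : ℕ in atTop, 0 < log (N : ℝ) :=
    (tendsto_log_atTop.comp tendsto_natCast_atTop_atTop).eventually_gt_atTop 0
  refine tendsto_order.mpr ⟨fun c hc ↦ ?_, fun c hc ↦ ?_⟩
  · obtain ⟨d, hd, hd1⟩ := exists_between (max_lt hc one_pos)
    have herr : Tendsto (fun N : ℕ ↦ log (N : ℝ) / √N / log (log N)) atTop (nhds 0) := by
      have h1 : Tendsto (fun x : ℝ ↦ log x / √x) atTop (nhds 0) := by
        simp only [sqrt_eq_rpow]
        exact (isLittleO_log_rpow_atTop (by norm_num)).tendsto_div_nhds_zero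
      exact (h1.div_atTop (tendsto_log_atTop.comp tendsto_log_atTop)).comp
        tendsto_natCast_atTop_atTop
    have hlim := ((hA (show (0 : ℝ) < 1 / 4 by norm_num)).const_mul d).sub herr
    rw [mul_one, sub_zero] at hlim
    filter_upwards [hlim.eventually_const_lt ((le_max_left c 0).trans_lt hd), hll, hl,
      eventually_le_semiprimeCount ((le_max_right c 0).trans hd.le) hd1, eventually_gt_atTop 0]
      with N h1 h2 h3 h4 h5
    have hN : (0 : ℝ) < N := by exact_mod_cast h5
    have hs := sqrt_pos.mpr hN
    refine h1.trans_le ?_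
    rw [le_div_iff₀ (by positivity)]
    rw [← sub_le_iff_le_add] at h4
    have hsq : (N : ℝ) / √N = √N := div_sqrt
    calc _ = (d * (N / log N) * ∑ p ∈ Nat.primesLE ⌊(N : ℝ) ^ (1 / 4 : ℝ)⌋₊, (p : ℝ)⁻¹ -
          N / √N) * log N := by field_simp
      _ ≤ _ := by
        rw [hsq]
        gcongr
  · have hδ : ∃ δ : ℝ, 0 < δ ∧ δ < 1 / 2 ∧ (1 + δ) * ((1 - δ)⁻¹ * 1 + 2 * (1 - 1)) < c := by
      have hcont : Tendsto (fun δ : ℝ ↦ (1 + δ) * ((1 - δ)⁻¹ * 1 + 2 * (1 - 1)))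
          (nhdsWithin 0 (Set.Ioi 0)) (nhds 1) := by
        have h : ContinuousAt (fun δ : ℝ ↦ (1 + δ) * ((1 - δ)⁻¹ * 1 + 2 * (1 - 1))) 0 := by
          refine ContinuousAt.mul (by fun_prop) (ContinuousAt.add (ContinuousAt.mul ?_ (by fun_prop))
            (by fun_prop))
          exact ContinuousAt.inv₀ (by fun_prop) (by norm_num)
        have h' := h.tendsto.mono_left (nhdsWithin_le_nhds (s := Set.Ioi 0))
        norm_num at h'
        norm_num
        exact h'
      obtain ⟨δ, h1, h2, h3⟩ := ((hcont.eventually_lt_const hc).and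
        ((Ioo_mem_nhdsGT (show (0 : ℝ) < 1 / 2 by norm_num)))).exists
      exact ⟨δ, h2, h3, h1⟩
    obtain ⟨δ, hδ0, hδ1, hδc⟩ := hδ
    have hlim := (((hA hδ0).const_mul (1 - δ)⁻¹).add
      (((hA (show (0 : ℝ) < 1 / 2 by norm_num)).sub (hA hδ0)).const_mul 2)).const_mul (1 + δ)
    filter_upwards [hlim.eventually_lt_const hδc, hll, hl,
      eventually_semiprimeCount_le hδ0 hδ1, eventually_gt_atTop 0] with N h1 h2 h3 h4 h5
    have hN : (0 : ℝ) < N := by exact_mod_cast h5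
    refine lt_of_le_of_lt ?_ h1
    rw [div_le_iff₀ (by positivity)]
    refine (mul_le_mul_of_nonneg_right h4 h3.le).trans_eq ?_
    field_simp

end SemiprimeAsymptotics

/-- π₂(pₙ) ∼ n · log log n as n → ∞. -/
theorem semiprimes_up_to_nth_prime :
    Tendsto (fun n : ℕ =>
        (semiprimeCount (nthPrime n) : ℝ) / (n * Real.log (Real.log n)))
      atTop (nhds 1) := by
  have hq : Tendsto nthPrime atTop atTop :=
    (Nat.nth_strictMono Nat.infinite_setOfPred_prime).tendsto_atTop.comp (tendsto_sub_atTop_nat 1)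
  have hq' : Tendsto (fun n ↦ (nthPrime n : ℝ)) atTop atTop :=
    tendsto_natCast_atTop_atTop.comp hq
  have h := ((tendsto_semiprimeCount_mul_log_div.comp hq).div
    (tendsto_primeCounting_mul_log_div.comp hq') one_ne_zero).div
    ((tendsto_log_log_primeCounting_div 0).comp hq') one_ne_zero
  rw [div_one, div_one] at h
  refine h.congr' ?_
  filter_upwards [eventually_ge_atTop 1, (tendsto_log_atTop.comp hq').eventually_gt_atTop 0,
    ((tendsto_log_atTop.comp tendsto_log_atTop).comp hq').eventually_gt_atTop 0,
    hq'.eventually_gt_atTop 0] with n hn h1 h2 h3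
  have hpi : Nat.primeCounting (nthPrime n) = n := by
    rw [nthPrime, primeCounting_nth_prime, Nat.sub_add_cancel hn]
  simp only [Function.comp_apply] at h1 h2
  simp only [Pi.div_apply, Function.comp_apply, Nat.floor_natCast, hpi, add_zero]
  field_simp
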